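/- Suppose w₁ and w₂ are finite binary words such that w₁ is not a prefix of w₂, and the word obtained from w₂ by deleting its last two letters is not a prefix of w₁. Then there exists g in the Grigorchuk group 𝒢 such that g(w₂) ≠ w₂ while g(w₁·u) = w₁·u for every finite binary word u. -/

import Mathlib

/-- The Grigorchuk generator `a` on finite binary words: flips the first letter. -/
def aMap : List Bool → List Bool
  | [] => []
  | x :: w => (!x) :: w

theorem aMap_invol : ∀ w, aMap (aMap w) = w
  | [] => rfl
  | x :: w => by cases x <;> rfl

mutual
  /-- The Grigorchuk generator `b`: `b(∅)=∅`, `b(0w)=0·a(w)`, `b(1w)=1·c(w)`. -/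
  def bMap : List Bool → List Bool
    | [] => []
    | false :: w => false :: aMap w
    | true :: w => true :: cMap w
  /-- The Grigorchuk generator `c`: `c(∅)=∅`, `c(0w)=0·a(w)`, `c(1w)=1·d(w)`. -/
  def cMap : List Bool → List Bool
    | [] => []
    | false :: w => false :: aMap w
    | true :: w => true :: dMap w
  /-- The Grigorchuk generator `d`: `d(∅)=∅`, `d(0w)=0·w`, `d(1w)=1·b(w)`. -/
  def dMap : List Bool → List Bool
    | [] => []
    | false :: w => false :: w
    | true :: w => true :: bMap w
end

theorem bcd_invol : ∀ w : List Bool,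
    bMap (bMap w) = w ∧ cMap (cMap w) = w ∧ dMap (dMap w) = w := by
  intro w
  induction w with
  | nil => exact ⟨rfl, rfl, rfl⟩
  | cons x w ih =>
    cases x <;>
      simp [bMap, cMap, dMap, aMap_invol, ih.1, ih.2.1, ih.2.2]

/-- `a` as a permutation of the set of finite binary words. -/
def aPerm : Equiv.Perm (List Bool) := ⟨aMap, aMap, aMap_invol, aMap_invol⟩

/-- `b` as a permutation of the set of finite binary words. -/
def bPerm : Equiv.Perm (List Bool) :=
  ⟨bMap, bMap, fun w => (bcd_invol w).1, fun w => (bcd_invol w).1⟩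

/-- `c` as a permutation of the set of finite binary words. -/
def cPerm : Equiv.Perm (List Bool) :=
  ⟨cMap, cMap, fun w => (bcd_invol w).2.1, fun w => (bcd_invol w).2.1⟩

/-- `d` as a permutation of the set of finite binary words. -/
def dPerm : Equiv.Perm (List Bool) :=
  ⟨dMap, dMap, fun w => (bcd_invol w).2.2, fun w => (bcd_invol w).2.2⟩

/-- The Grigorchuk group: the group of bijections of `X*` generated by `a, b, c, d`. -/
def Grig : Subgroup (Equiv.Perm (List Bool)) :=
  Subgroup.closure {aPerm, bPerm, cPerm, dPerm}

/-- The permutation acting as `p.1` below `0` and as `p.2` below `1`. -/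
def pairMap (p : Equiv.Perm (List Bool) × Equiv.Perm (List Bool)) : List Bool → List Bool
  | [] => []
  | false :: w => false :: p.1 w
  | true :: w => true :: p.2 w

def pairHom : Equiv.Perm (List Bool) × Equiv.Perm (List Bool) →* Equiv.Perm (List Bool) where
  toFun p := ⟨pairMap p, pairMap p⁻¹,
    by rintro (_ | ⟨_ | _, w⟩) <;> simp [pairMap],
    by rintro (_ | ⟨_ | _, w⟩) <;> simp [pairMap]⟩
  map_one' := by ext1 w; rcases w with (_ | ⟨_ | _, w⟩) <;> rfl
  map_mul' p q := by ext1 w; rcases w with (_ | ⟨_ | _, w⟩) <;> rfl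

theorem b_pair : bPerm = pairHom (aPerm, cPerm) := by
  ext1 w; rcases w with (_ | ⟨_ | _, w⟩) <;> simp [bPerm, pairHom, pairMap, bMap, aPerm, cPerm]

theorem c_pair : cPerm = pairHom (aPerm, dPerm) := by
  ext1 w; rcases w with (_ | ⟨_ | _, w⟩) <;> simp [cPerm, pairHom, pairMap, cMap, aPerm, dPerm]

theorem d_pair : dPerm = pairHom (1, bPerm) := by
  ext1 w; rcases w with (_ | ⟨_ | _, w⟩) <;> simp [dPerm, pairHom, pairMap, dMap, bPerm]

theorem a_conj (g h : Equiv.Perm (List Bool)) :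
    aPerm * pairHom (g, h) * aPerm = pairHom (h, g) := by
  ext1 w; rcases w with (_ | ⟨_ | _, w⟩) <;> simp [aPerm, pairHom, pairMap, aMap]

theorem a_sq : aPerm * aPerm = 1 := by ext1 w; exact aMap_invol w
theorem b_sq : bPerm * bPerm = 1 := by ext1 w; exact (bcd_invol w).1
theorem c_sq : cPerm * cPerm = 1 := by ext1 w; exact (bcd_invol w).2.1

theorem bcd_comm : ∀ w : List Bool, cMap (bMap w) = bMap (cMap w) ∧
    cMap (dMap w) = dMap (cMap w) ∧ bMap (dMap w) = dMap (bMap w) := by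
  intro w
  induction w with
  | nil => exact ⟨rfl, rfl, rfl⟩
  | cons x w ih => cases x <;> simp [bMap, cMap, dMap, ih]

theorem cb_comm : cPerm * bPerm = bPerm * cPerm := by ext1 w; exact (bcd_comm w).1

theorem a_mem : aPerm ∈ Grig := Subgroup.subset_closure (by simp)
theorem b_mem : bPerm ∈ Grig := Subgroup.subset_closure (by simp)
theorem c_mem : cPerm ∈ Grig := Subgroup.subset_closure (by simp)
theorem d_mem : dPerm ∈ Grig := Subgroup.subset_closure (by simp)

theorem exists_sect {h : Equiv.Perm (List Bool)} (hh : h ∈ Grig) :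
    ∃ f, pairHom (h, f) ∈ Grig := by
  have conj : ∀ g ∈ Grig, aPerm * g * aPerm ∈ Grig := fun g hg =>
    mul_mem (mul_mem a_mem hg) a_mem
  induction hh using Subgroup.closure_induction with
  | mem x hx =>
    simp only [Set.mem_insert_iff, Set.mem_singleton_iff] at hx
    rcases hx with rfl | rfl | rfl | rfl
    · exact ⟨_, b_pair ▸ b_mem⟩
    · exact ⟨1, by rw [← a_conj, ← d_pair]; exact conj _ d_mem⟩
    · exact ⟨aPerm, by rw [← a_conj, ← b_pair]; exact conj _ b_mem⟩
    · exact ⟨aPerm, by rw [← a_conj, ← c_pair]; exact conj _ c_mem⟩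
  | one => exact ⟨1, by rw [← Prod.one_eq_mk, map_one]; exact one_mem _⟩
  | mul x y _ _ hx hy =>
    obtain ⟨f, hf⟩ := hx
    obtain ⟨g, hg⟩ := hy
    exact ⟨f * g, by rw [← Prod.mk_mul_mk, map_mul]; exact mul_mem hf hg⟩
  | inv x _ hx =>
    obtain ⟨f, hf⟩ := hx
    exact ⟨f⁻¹, by rw [← Prod.inv_mk, map_inv]; exact inv_mem hf⟩

/-- The element `(ab)²`. -/
def kPerm : Equiv.Perm (List Bool) := aPerm * bPerm * aPerm * bPerm

/-- The normal closure of `(ab)²` in the Grigorchuk group. -/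
def KSub : Subgroup (Equiv.Perm (List Bool)) :=
  Subgroup.closure {x | ∃ g ∈ Grig, x = g * kPerm * g⁻¹}

theorem k_grig : kPerm ∈ Grig :=
  mul_mem (mul_mem (mul_mem a_mem b_mem) a_mem) b_mem

theorem K_le : KSub ≤ Grig := by
  refine (Subgroup.closure_le _).2 ?_
  rintro x ⟨g, hg, rfl⟩
  exact mul_mem (mul_mem hg k_grig) (inv_mem hg)

theorem k_mem : kPerm ∈ KSub := Subgroup.subset_closure ⟨1, one_mem _, by simp⟩

theorem K_conj {g x : Equiv.Perm (List Bool)} (hg : g ∈ Grig) (hx : x ∈ KSub) :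
    g * x * g⁻¹ ∈ KSub := by
  induction hx using Subgroup.closure_induction with
  | mem x hx =>
    obtain ⟨h, hh, rfl⟩ := hx
    exact Subgroup.subset_closure ⟨g * h, mul_mem hg hh, by group⟩
  | one => simp
  | mul x y _ _ hx hy =>
    have := mul_mem hx hy
    convert this using 1
    group
  | inv x _ hx =>
    have := inv_mem hx
    convert this using 1
    group

theorem lift_k : pairHom (kPerm, 1) ∈ KSub := by
  have had : pairHom (bPerm, 1) ∈ Grig := by
    rw [← a_conj, ← d_pair]; exact mul_mem (mul_mem a_mem d_mem) a_mem
  have hab : pairHom (cPerm, aPerm) ∈ Grig := by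
    rw [← a_conj, ← b_pair]; exact mul_mem (mul_mem a_mem b_mem) a_mem
  have hk : kPerm = pairHom (cPerm * aPerm, aPerm * cPerm) := by
    rw [← Prod.mk_mul_mk, map_mul, ← a_conj, ← b_pair, kPerm]
  have ha : aPerm⁻¹ = aPerm := inv_eq_of_mul_eq_one_left a_sq
  have hb : bPerm⁻¹ = bPerm := inv_eq_of_mul_eq_one_left b_sq
  have hc : cPerm⁻¹ = cPerm := inv_eq_of_mul_eq_one_left c_sq
  have h1 := K_conj hab (mul_mem k_mem (K_conj had (inv_mem k_mem)))
  convert h1 using 1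
  rw [hk, ← map_inv, ← map_inv, ← map_inv, ← map_mul, ← map_mul, ← map_mul, ← map_mul, ← map_mul]
  congr 1
  ext1
  · simp only [Prod.fst_mul, Prod.fst_inv, mul_inv_rev, ha, hb, hc]
    have e : cPerm * bPerm * cPerm = bPerm := by rw [cb_comm, mul_assoc, c_sq, mul_one]
    calc _ = (1 * aPerm * bPerm * aPerm * bPerm) := by rw [← hk, kPerm, one_mul]
      _ = (cPerm * cPerm) * aPerm * bPerm * aPerm * (cPerm * bPerm * cPerm) := by rw [e, c_sq]
      _ = _ := by simp only [mul_assoc]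
  · simp

theorem lift_false {x : Equiv.Perm (List Bool)} (hx : x ∈ KSub) : pairHom (x, 1) ∈ KSub := by
  induction hx using Subgroup.closure_induction with
  | mem x hx =>
    obtain ⟨h, hh, rfl⟩ := hx
    obtain ⟨f, hf⟩ := exists_sect hh
    have := K_conj hf lift_k
    rw [← map_inv, ← map_mul, ← map_mul] at this
    simpa using this
  | one => rw [← Prod.one_eq_mk, map_one]; exact one_mem _
  | mul x y _ _ hx hy =>
    have := mul_mem hx hy
    rw [← map_mul] at this
    simpa using this
  | inv x _ hx =>
    have := inv_mem hx
    rw [← map_inv] at this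
    simpa using this

theorem lift_true {x : Equiv.Perm (List Bool)} (hx : x ∈ KSub) : pairHom (1, x) ∈ KSub := by
  have := K_conj a_mem (lift_false hx)
  rwa [inv_eq_of_mul_eq_one_left a_sq, a_conj] at this

theorem exists_rist (v : List Bool) : ∃ g ∈ KSub, (∀ t, g (v ++ t) = v ++ kPerm t) ∧
    ∀ u, ¬ v <+: u → g u = u := by
  induction v with
  | nil => exact ⟨kPerm, k_mem, fun _ => rfl, fun u hu => absurd List.nil_prefix hu⟩
  | cons x v ih =>
    obtain ⟨g, hg, h1, h2⟩ := ih
    cases x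
    · refine ⟨_, lift_false hg, fun t => ?_, fun u hu => ?_⟩
      · simp [pairHom, pairMap, h1]
      · rcases u with (_ | ⟨_ | _, u⟩) <;> simp [pairHom, pairMap]
        exact h2 _ (by simpa using hu)
    · refine ⟨_, lift_true hg, fun t => ?_, fun u hu => ?_⟩
      · simp [pairHom, pairMap, h1]
      · rcases u with (_ | ⟨_ | _, u⟩) <;> simp [pairHom, pairMap]
        exact h2 _ (by simpa using hu)

theorem k_moves (x y : Bool) : kPerm [x, y] ≠ [x, y] := by
  cases x <;> cases y <;> simp [kPerm, aPerm, bPerm, aMap, bMap, cMap]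

theorem exists_two (w : List Bool) (h : w.dropLast.dropLast ≠ []) :
    ∃ x y, w = w.dropLast.dropLast ++ [x, y] := by
  have h1 : w.dropLast ≠ [] := by rintro e; simp [e] at h
  have h0 : w ≠ [] := by rintro e; simp [e] at h1
  refine ⟨w.dropLast.getLast h1, w.getLast h0, ?_⟩
  conv_lhs => rw [← List.dropLast_append_getLast h0, ← List.dropLast_append_getLast h1]
  simp

/-- If `w₁` is not a prefix of `w₂`, and `w₂` with its last two letters deleted is not
a prefix of `w₁`, then some `g` in the Grigorchuk group `𝒢` does not fix `w₂` while
fixing every finite binary word with prefix `w₁`. -/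
theorem grigorchuk_separation (w₁ w₂ : List Bool)
    (h₁ : ¬ w₁ <+: w₂) (h₂ : ¬ (w₂.dropLast.dropLast <+: w₁)) :
    ∃ g ∈ Grig, g w₂ ≠ w₂ ∧ ∀ u : List Bool, g (w₁ ++ u) = w₁ ++ u := by

  obtain ⟨g, hg, hg1, hg2⟩ := exists_rist w₂.dropLast.dropLast
  refine ⟨g, K_le hg, ?_, fun u => hg2 _ fun hp => ?_⟩
  · obtain ⟨x, y, e⟩ := exists_two w₂ (fun e => h₂ (e ▸ List.nil_prefix))
    intro hf
    rw [e, hg1 [x, y]] at hf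
    exact k_moves x y (List.append_cancel_left hf)
  · rcases List.prefix_or_prefix_of_prefix hp (List.prefix_append w₁ u) with h | h
    · exact h₂ h
    · exact h₁ (h.trans ((List.dropLast_prefix _).trans (List.dropLast_prefix _)))
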